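/- Let G be a cactus graph and ℓ ≥ 4 an integer. Then for every pair of proper ℓ-colorings α and β of G there exists a transformation from α to β recoloring each vertex at most 3 times. -/

import Mathlib

open SimpleGraph

/-- A proper coloring of `G` with `ℓ` colors: adjacent vertices get distinct colors. -/
def IsProperColoring {V : Type} (G : SimpleGraph V) {ℓ : ℕ} (c : V → Fin ℓ) : Prop :=
  ∀ ⦃u v : V⦄, G.Adj u v → c u ≠ c v

/-- `c` is a transformation sequence from `α` to `β`: a sequence of proper colorings
starting at `α`, ending at `β`, in which consecutive colorings differ on exactly one vertex. -/
def IsTransformSeq {V : Type} (G : SimpleGraph V) {ℓ m : ℕ}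
    (c : Fin (m + 1) → V → Fin ℓ) (α β : V → Fin ℓ) : Prop :=
  c 0 = α ∧ c (Fin.last m) = β ∧ (∀ i, IsProperColoring G (c i)) ∧
    ∀ i : Fin m, ∃! v : V, c i.castSucc v ≠ c i.succ v

/-- The number of steps of the sequence `c` at which the vertex `v` is recolored. -/
def RecolorCount {V : Type} {ℓ m : ℕ} (c : Fin (m + 1) → V → Fin ℓ) (v : V) : ℕ :=
  (Finset.univ.filter fun i : Fin m => c i.castSucc v ≠ c i.succ v).card

/-- `H` is a minor of `G`: there are pairwise disjoint nonempty branch sets in `G`, each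
inducing a connected subgraph, with an edge of `G` between the branch sets of any two
vertices adjacent in `H`. -/
def IsMinor {W V : Type} (H : SimpleGraph W) (G : SimpleGraph V) : Prop :=
  ∃ B : W → Set V,
    (∀ h, (B h).Nonempty) ∧
    (Pairwise fun h h' => Disjoint (B h) (B h')) ∧
    (∀ h, (G.induce (B h)).Connected) ∧
    ∀ ⦃h h'⦄, H.Adj h h' → ∃ u ∈ B h, ∃ v ∈ B h', G.Adj u v

/-- Every edge of `G` lies on at most one cycle: two cycles sharing an edge have the
same edge set. -/
def EdgeOnAtMostOneCycle {V : Type} (G : SimpleGraph V) : Prop :=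
  ∀ (u v : V) (p : G.Walk u u) (q : G.Walk v v), p.IsCycle → q.IsCycle →
    ∀ e, e ∈ p.edges → e ∈ q.edges → ∀ e', (e' ∈ p.edges ↔ e' ∈ q.edges)

/-- A cactus graph: connected and every edge lies on at most one cycle. -/
def IsCactus {V : Type} (G : SimpleGraph V) : Prop :=
  G.Connected ∧ EdgeOnAtMostOneCycle G

/-- A chordal graph: every cycle of length at least `4` has a chord; equivalently,
there is no induced cycle of length at least `4`. -/
def IsChordal {V : Type} (G : SimpleGraph V) : Prop :=
  ∀ (v : V) (p : G.Walk v v), p.IsCycle → 4 ≤ p.length →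
    ∃ u w, u ∈ p.support ∧ w ∈ p.support ∧ G.Adj u w ∧ s(u, w) ∉ p.edges

/-- The sequence of successive colors taken by the vertex `v` along the sequence `c`
(its starting color followed by the new color at each of its recolorings). -/
def ColorTrace {V : Type} {ℓ m : ℕ} (c : Fin (m + 1) → V → Fin ℓ) (v : V) : List (Fin ℓ) :=
  (List.ofFn fun i : Fin (m + 1) => c i v).destutter (· ≠ ·)

/-- The colors of a vertex before, between and after three passes that each recolor it at most
once, together with its priorities in these passes (smaller priorities move first). -/
structure Schedule (C : Type) where
  c0 : C
  c1 : C
  c2 : C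
  c3 : C
  h1 : ℤ
  h2 : ℤ
  h3 : ℤ

/-- Two adjacent vertices with colors `a`, `b` can be recolored to `a'`, `b'` in the order given
by the priorities `h`, `k`. -/
def PassOK {C : Type} (a a' : C) (h : ℤ) (b b' : C) (k : ℤ) : Prop :=
  a ≠ b ∧ a' ≠ b' ∧ (a' = b → k < h) ∧ (b' = a → h < k)

/-- Two schedules may be followed by adjacent vertices. -/
def Compatible {C : Type} (x y : Schedule C) : Prop :=
  PassOK x.c0 x.c1 x.h1 y.c0 y.c1 y.h1 ∧ PassOK x.c1 x.c2 x.h2 y.c1 y.c2 y.h2 ∧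
    PassOK x.c2 x.c3 x.h3 y.c2 y.c3 y.h3

/-- For any three colors there is a fourth one. -/
def HasFourColors (C : Type) : Prop :=
  ∀ a b c : C, ∃ d, d ≠ a ∧ d ≠ b ∧ d ≠ c

section Schedules

variable {C : Type}

lemma PassOK.symm {a a' b b' : C} {h k : ℤ} (H : PassOK a a' h b b' k) : PassOK b b' k a a' h :=
  ⟨H.1.symm, H.2.1.symm, H.2.2.2, H.2.2.1⟩

lemma Compatible.symm {x y : Schedule C} (H : Compatible x y) : Compatible y x :=
  ⟨H.1.symm, H.2.1.symm, H.2.2.symm⟩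

/-- The schedule run backwards in time. -/
def Schedule.rev (x : Schedule C) : Schedule C :=
  ⟨x.c3, x.c2, x.c1, x.c0, -x.h3, -x.h2, -x.h1⟩

lemma PassOK.rev {a a' b b' : C} {h k : ℤ} (H : PassOK a a' h b b' k) :
    PassOK a' a (-h) b' b (-k) := by
  obtain ⟨h1, h2, h3, h4⟩ := H
  refine ⟨h2, h1, fun e => ?_, fun e => ?_⟩
  · have := h4 e.symm
    lia
  · have := h3 e.symm
    lia

lemma Compatible.rev {x y : Schedule C} (H : Compatible x y) : Compatible x.rev y.rev :=
  ⟨H.2.2.rev, H.2.1.rev, H.1.rev⟩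

lemma Schedule.rev_rev (x : Schedule C) : x.rev.rev = x := by
  simp [Schedule.rev]

lemma exists_passOK_of_no_swap {a a' b b' : C} (h : ℤ) (h0 : a ≠ b) (h1 : a' ≠ b')
    (h2 : ¬ (a' = b ∧ b' = a)) : ∃ k, PassOK a a' h b b' k := by
  by_cases e : a' = b
  · exact ⟨h - 1, h0, h1, fun _ => by lia, fun e' => absurd ⟨e, e'⟩ h2⟩
  · exact ⟨h + 1, h0, h1, fun e' => absurd e' e, fun _ => by lia⟩

lemma exists_passOK_of_not_copied {a a' b b' d d' : C} (h k : ℤ) (h0 : a ≠ b) (h1 : a' ≠ b')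
    (h0' : d ≠ b) (h1' : d' ≠ b') (h2 : a' ≠ b) (h3 : d' ≠ b) :
    ∃ j, PassOK a a' h b b' j ∧ PassOK d d' k b b' j :=
  ⟨max h k + 1, ⟨h0, h1, fun e => absurd e h2, fun _ => by lia⟩,
    ⟨h0', h1', fun e => absurd e h3, fun _ => by lia⟩⟩

lemma passOK_of_no_copy {a a' b b' : C} (h k : ℤ) (h0 : a ≠ b) (h1 : a' ≠ b')
    (h2 : a' ≠ b) (h3 : b' ≠ a) : PassOK a a' h b b' k :=
  ⟨h0, h1, fun e => absurd e h2, fun e => absurd e h3⟩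

lemma exists_compatible (hC : HasFourColors C) (q : Schedule C) {x0 x3 : C} (z : C)
    (h0 : q.c0 ≠ x0) (h3 : q.c3 ≠ x3) :
    ∃ x : Schedule C, x.c0 = x0 ∧ x.c3 = x3 ∧ x.c1 ≠ z ∧ Compatible q x := by
  obtain ⟨x1, h11, h12, h13⟩ := hC q.c1 z q.c0
  obtain ⟨x2, h21, h22, h23⟩ := hC q.c2 q.c1 q.c3
  obtain ⟨k1, hk1⟩ := exists_passOK_of_no_swap (a := q.c0) (a' := q.c1) (b := x0) (b' := x1)
    q.h1 (by grind) (by grind) (by grind)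
  obtain ⟨k2, hk2⟩ := exists_passOK_of_no_swap (a := q.c1) (a' := q.c2) (b := x1) (b' := x2)
    q.h2 (by grind) (by grind) (by grind)
  obtain ⟨k3, hk3⟩ := exists_passOK_of_no_swap (a := q.c2) (a' := q.c3) (b := x2) (b' := x3)
    q.h3 (by grind) (by grind) (by grind)
  exact ⟨⟨x0, x1, x2, x3, k1, k2, k3⟩, rfl, rfl, h12, hk1, hk2, hk3⟩

lemma exists_three_between (hC : HasFourColors C) (q b : Schedule C) {p0 a0 x0 p3 a3 x3 : C}
    (hq0 : q.c0 ≠ p0) (hp0 : p0 ≠ a0) (ha0 : a0 ≠ x0) (hx0 : b.c0 ≠ x0)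
    (hq3 : q.c3 ≠ p3) (hp3 : p3 ≠ a3) (ha3 : a3 ≠ x3) (hx3 : b.c3 ≠ x3) (hb : b.c1 ≠ x0) :
    ∃ p a x : Schedule C, p.c0 = p0 ∧ p.c3 = p3 ∧ a.c0 = a0 ∧ a.c3 = a3 ∧ x.c0 = x0 ∧ x.c3 = x3 ∧
      Compatible q p ∧ Compatible p a ∧ Compatible a x ∧ Compatible x b := by
  obtain ⟨p2, hp2⟩ : ∃ p2, p2 ≠ q.c2 ∧ p2 ≠ a3 ∧ (p3 = q.c2 → p2 ≠ q.c3) ∧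
      (p3 ≠ q.c2 → p2 ≠ q.c1) := by
    by_cases e : p3 = q.c2
    · obtain ⟨d, hd⟩ := hC q.c2 a3 q.c3
      exact ⟨d, by grind⟩
    · obtain ⟨d, hd⟩ := hC q.c2 a3 q.c1
      exact ⟨d, by grind⟩
  obtain ⟨p1, hp1⟩ : ∃ p1, p1 ≠ q.c1 ∧ (p1 = a0 → p0 = q.c1 ∧ p2 = q.c1) ∧
      (p0 = q.c1 → p1 ≠ q.c0) ∧ (p2 = q.c1 → p1 ≠ q.c2) := by
    by_cases e : p0 = q.c1
    · by_cases e' : p2 = q.c1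
      · obtain ⟨d, hd⟩ := hC q.c1 q.c0 q.c2
        exact ⟨d, by grind⟩
      · obtain ⟨d, hd⟩ := hC q.c1 q.c0 a0
        exact ⟨d, by grind⟩
    · obtain ⟨d, hd⟩ := hC q.c1 q.c2 a0
      exact ⟨d, by grind⟩
  obtain ⟨a1, ha1⟩ := hC p1 p2 x0
  obtain ⟨a2, ha2⟩ := hC p1 p2 p3
  obtain ⟨x1, x2, h1, h1', h2, h2', hs3, hs3', hs2, hs2'⟩ : ∃ x1 x2, x1 ≠ a1 ∧ x1 ≠ b.c1 ∧
      x2 ≠ a2 ∧ x2 ≠ b.c2 ∧ (x3 = a2 → x2 ≠ a3) ∧ (x3 = b.c2 → x2 ≠ b.c3) ∧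
      ¬ (x1 = a2 ∧ x2 = a1) ∧ ¬ (x1 = b.c2 ∧ x2 = b.c1) := by
    obtain ⟨x2, h2⟩ : ∃ x2, x2 ≠ a2 ∧ x2 ≠ b.c2 ∧ (x3 = a2 → x2 ≠ a3) ∧
        (x3 = b.c2 → x2 ≠ b.c3) := by
      by_cases e : x3 = a2
      · by_cases e' : x3 = b.c2
        · obtain ⟨d, hd⟩ := hC a2 a3 b.c3
          exact ⟨d, by grind⟩
        · obtain ⟨d, hd⟩ := hC a2 b.c2 a3
          exact ⟨d, by grind⟩
      · obtain ⟨d, hd⟩ := hC a2 b.c2 b.c3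
        exact ⟨d, by grind⟩
    by_cases e : x2 = a1
    · by_cases e' : x2 = b.c1
      · obtain ⟨d, hd⟩ := hC a1 a2 b.c2
        exact ⟨d, x2, by grind⟩
      · obtain ⟨d, hd⟩ := hC a1 b.c1 a2
        exact ⟨d, x2, by grind⟩
    · obtain ⟨d, hd⟩ := hC a1 b.c1 b.c2
      exact ⟨d, x2, by grind⟩
  obtain ⟨kp1, hkp1⟩ := exists_passOK_of_no_swap (a := q.c0) (a' := q.c1) (b := p0) (b' := p1)
    q.h1 (by grind) (by grind) (by grind)
  obtain ⟨kp2, hkp2⟩ := exists_passOK_of_no_swap (a := q.c1) (a' := q.c2) (b := p1) (b' := p2)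
    q.h2 (by grind) (by grind) (by grind)
  obtain ⟨kp3, hkp3⟩ := exists_passOK_of_no_swap (a := q.c2) (a' := q.c3) (b := p2) (b' := p3)
    q.h3 (by grind) (by grind) (by grind)
  obtain ⟨ka1, hka1⟩ := exists_passOK_of_no_swap (a := p0) (a' := p1) (b := a0) (b' := a1)
    kp1 (by grind) (by grind) (by grind)
  obtain ⟨kx1, hkx1, hkx1'⟩ := exists_passOK_of_not_copied (a := a0) (a' := a1) (b := x0)
    (b' := x1) (d := b.c0) (d' := b.c1) ka1 b.h1 (by grind) (by grind) (by grind) (by grind)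
    (by grind) (by grind)
  obtain ⟨kx2, hkx2⟩ := exists_passOK_of_no_swap (a := b.c1) (a' := b.c2) (b := x1) (b' := x2)
    b.h2 (by grind) (by grind) (by grind)
  obtain ⟨kx3, hkx3⟩ := exists_passOK_of_no_swap (a := b.c2) (a' := b.c3) (b := x2) (b' := x3)
    b.h3 (by grind) (by grind) (by grind)
  obtain ⟨ka2, hka2⟩ := exists_passOK_of_no_swap (a := x1) (a' := x2) (b := a1) (b' := a2)
    kx2 (by grind) (by grind) (by grind)
  obtain ⟨ka3, hka3⟩ := exists_passOK_of_no_swap (a := x2) (a' := x3) (b := a2) (b' := a3)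
    kx3 (by grind) (by grind) (by grind)
  exact ⟨⟨p0, p1, p2, p3, kp1, kp2, kp3⟩, ⟨a0, a1, a2, a3, ka1, ka2, ka3⟩,
    ⟨x0, x1, x2, x3, kx1, kx2, kx3⟩, rfl, rfl, rfl, rfl, rfl, rfl, ⟨hkp1, hkp2, hkp3⟩,
    ⟨hka1, passOK_of_no_copy _ _ (by grind) (by grind) (by grind) (by grind),
      passOK_of_no_copy _ _ (by grind) (by grind) (by grind) (by grind)⟩,
    ⟨hkx1, hka2.symm, hka3.symm⟩, ⟨hkx1'.symm, hkx2.symm, hkx3.symm⟩⟩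

/-- Schedules for the three other vertices of a four-cycle through a vertex with schedule `b`. -/
lemma exists_three_of_cycle (hC : HasFourColors C) (b : Schedule C) {p0 a0 x0 p3 a3 x3 : C}
    (hq0 : b.c0 ≠ p0) (hp0 : p0 ≠ a0) (ha0 : a0 ≠ x0) (hx0 : b.c0 ≠ x0)
    (hq3 : b.c3 ≠ p3) (hp3 : p3 ≠ a3) (ha3 : a3 ≠ x3) (hx3 : b.c3 ≠ x3) :
    ∃ p a x : Schedule C, p.c0 = p0 ∧ p.c3 = p3 ∧ a.c0 = a0 ∧ a.c3 = a3 ∧ x.c0 = x0 ∧ x.c3 = x3 ∧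
      Compatible b p ∧ Compatible p a ∧ Compatible a x ∧ Compatible x b := by
  by_cases e1 : b.c1 = x0
  swap
  · exact exists_three_between hC b b hq0 hp0 ha0 hx0 hq3 hp3 ha3 hx3 e1
  by_cases e2 : b.c1 = p0
  swap
  · obtain ⟨x, a, p, h1, h2, h3, h4, h5, h6, h7, h8, h9, h10⟩ := exists_three_between hC b b
      hx0 ha0.symm hp0.symm hq0 hx3 ha3.symm hp3.symm hq3 e2
    exact ⟨p, a, x, h5, h6, h3, h4, h1, h2, h10.symm, h9.symm, h8.symm, h7.symm⟩
  by_cases e3 : b.c2 = x3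
  swap
  · obtain ⟨p, a, x, h1, h2, h3, h4, h5, h6, h7, h8, h9, h10⟩ :=
      exists_three_between hC b.rev b.rev hq3 hp3 ha3 hx3 hq0 hp0 ha0 hx0 e3
    refine ⟨p.rev, a.rev, x.rev, h2, h1, h4, h3, h6, h5, ?_, h8.rev, h9.rev, ?_⟩
    · simpa [Schedule.rev_rev] using h7.rev
    · simpa [Schedule.rev_rev] using h10.rev
  by_cases e4 : b.c2 = p3
  swap
  · obtain ⟨x, a, p, h1, h2, h3, h4, h5, h6, h7, h8, h9, h10⟩ := exists_three_between hC
      b.rev b.rev hx3 ha3.symm hp3.symm hq3 hx0 ha0.symm hp0.symm hq0 e4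
    refine ⟨p.rev, a.rev, x.rev, h6, h5, h4, h3, h2, h1, ?_, h9.rev.symm, h8.rev.symm, ?_⟩
    · simpa [Schedule.rev_rev] using h10.rev.symm
    · simpa [Schedule.rev_rev] using h7.rev.symm
  subst e1 e3
  by_cases e : b.c1 = b.c2
  · obtain ⟨d, hd⟩ := hC b.c1 b.c0 a0
    obtain ⟨f, hf⟩ := hC b.c1 b.c3 a3
    refine ⟨⟨p0, d, f, p3, b.h1 - 1, b.h2, b.h3 + 1⟩, ⟨a0, b.c1, b.c1, a3, b.h1, b.h2, b.h3⟩,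
      ⟨b.c1, d, f, b.c2, b.h1 - 1, b.h2, b.h3 + 1⟩, rfl, rfl, rfl, rfl, rfl, rfl, ?_⟩
    simp only [Compatible, PassOK]
    grind
  · obtain ⟨p1, hp1⟩ := hC b.c1 b.c0 b.c0
    obtain ⟨p2, hp2⟩ := hC b.c1 b.c2 b.c3
    obtain ⟨a1, ha1⟩ := hC b.c1 p1 p1
    obtain ⟨x1, hx1⟩ := hC b.c0 b.c1 a1
    refine ⟨⟨p0, p1, p2, p3, b.h1 - 1, b.h2 - 1, b.h3 + 1⟩,
      ⟨a0, a1, b.c1, a3, b.h1 - 2, b.h2 - 2, b.h3 + 2⟩,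
      ⟨b.c1, x1, p2, b.c2, b.h1 - 1, b.h2 - 1, b.h3 + 1⟩, rfl, rfl, rfl, rfl, rfl, rfl, ?_⟩
    simp only [Compatible, PassOK]
    grind

lemma exists_passOK_triangle {a a' b b' x x' : C} (h : ℤ)
    (h1 : b ≠ a) (h2 : b ≠ x) (h3 : a ≠ x) (h1' : b' ≠ a') (h2' : b' ≠ x') (h3' : a' ≠ x')
    (s1 : ¬ (b' = a ∧ a' = b)) (s2 : ¬ (b' = x ∧ x' = b)) (s3 : ¬ (a' = x ∧ x' = a))
    (r1 : ¬ (b' = a ∧ a' = x ∧ x' = b)) (r2 : ¬ (b' = x ∧ x' = a ∧ a' = b)) :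
    ∃ j k, PassOK b b' h a a' j ∧ PassOK b b' h x x' k ∧ PassOK a a' j x x' k := by
  by_cases c1 : b' = a <;> by_cases c2 : b' = x
  · exact absurd (c1.symm.trans c2) h3
  · by_cases c3 : a' = x
    · exact ⟨h - 1, h - 2, by simp only [PassOK]; grind⟩
    · by_cases c4 : x' = b
      · exact ⟨h - 1, h + 1, by simp only [PassOK]; grind⟩
      · exact ⟨h - 1, h, by simp only [PassOK]; grind⟩
  · by_cases c3 : x' = a
    · exact ⟨h - 2, h - 1, by simp only [PassOK]; grind⟩
    · by_cases c4 : a' = b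
      · exact ⟨h + 1, h - 1, by simp only [PassOK]; grind⟩
      · exact ⟨h, h - 1, by simp only [PassOK]; grind⟩
  · by_cases c3 : a' = x
    · exact ⟨h + 2, h + 1, by simp only [PassOK]; grind⟩
    · exact ⟨h + 1, h + 2, by simp only [PassOK]; grind⟩

/-- The colors `b`, `a`, `x` of a triangle can be replaced by `b'`, `a'`, `x'` recoloring each
vertex at most once. -/
def TriangleOK (b b' a a' x x' : C) : Prop :=
  b' ≠ a' ∧ b' ≠ x' ∧ a' ≠ x' ∧ ¬ (b' = a ∧ a' = b) ∧ ¬ (b' = x ∧ x' = b) ∧ ¬ (a' = x ∧ x' = a) ∧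
    ¬ (b' = a ∧ a' = x ∧ x' = b) ∧ ¬ (b' = x ∧ x' = a ∧ a' = b)

lemma exists_triangle_of_free (hC : HasFourColors C) {b0 b1 b2 b3 a0 x0 a3 x3 : C}
    (h2 : b0 ≠ x0) (h3 : a0 ≠ x0) (h1' : b3 ≠ a3) (h2' : b3 ≠ x3) (h3' : a3 ≠ x3)
    (hx0 : x0 ≠ b1) (hx3 : x3 ≠ b2) :
    ∃ a1 a2 x1 x2, TriangleOK b0 b1 a0 a1 x0 x1 ∧ TriangleOK b1 b2 a1 a2 x1 x2 ∧
      TriangleOK b2 b3 a2 a3 x2 x3 := by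
  have key : ∀ a1 a2, a1 ≠ b1 → a1 ≠ x0 → (a0 = b1 → a1 ≠ b0) → a2 ≠ b2 → a2 ≠ x3 →
      (a3 = b2 → a2 ≠ b3) → ¬ (a1 = b2 ∧ a2 = b1) →
      ∃ a1 a2 x1 x2, TriangleOK b0 b1 a0 a1 x0 x1 ∧ TriangleOK b1 b2 a1 a2 x1 x2 ∧
        TriangleOK b2 b3 a2 a3 x2 x3 := by
    intro a1 a2 k1 k2 k3 k4 k5 k6 k7
    by_cases e : ∃ d, d ≠ a1 ∧ d ≠ b1 ∧ d ≠ a2 ∧ d ≠ b2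
    · obtain ⟨d, hd⟩ := e
      refine ⟨a1, a2, d, d, ?_, ?_, ?_⟩ <;> simp only [TriangleOK] <;> grind
    · have e' : ∀ d, d = a1 ∨ d = b1 ∨ d = a2 ∨ d = b2 := by
        intro d
        by_contra hd
        exact e ⟨d, by grind⟩
      obtain ⟨d1, hd1⟩ := hC a1 b1 b2
      obtain ⟨d2, hd2⟩ := hC a1 b1 a2
      have e1 := e' d1
      have e2 := e' d2
      refine ⟨a1, a2, a2, b1, ?_, ?_, ?_⟩ <;> simp only [TriangleOK] <;> grind
  by_cases e0 : a0 = b1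
  · obtain ⟨a1, ha1⟩ := hC b1 x0 b0
    by_cases e3 : a3 = b2
    · obtain ⟨a2, ha2⟩ := hC b2 x3 b3
      by_cases s : a1 = b2 ∧ a2 = b1
      · obtain ⟨x2, hx2⟩ := hC b1 b2 x0
        refine ⟨x0, b1, b2, x2, ?_, ?_, ?_⟩ <;> simp only [TriangleOK] <;> grind
      · exact key a1 a2 (by grind) (by grind) (by grind) (by grind) (by grind) (by grind) s
    · obtain ⟨a2, ha2⟩ := hC b2 x3 b1
      exact key a1 a2 (by grind) (by grind) (by grind) (by grind) (by grind) (by grind) (by grind)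
  · obtain ⟨a1, ha1⟩ := hC b1 x0 b2
    obtain ⟨a2, ha2⟩ := hC b2 x3 b3
    exact key a1 a2 (by grind) (by grind) (by grind) (by grind) (by grind) (by grind) (by grind)

lemma exists_triangle_of_copies (hC : HasFourColors C) {b0 b1 b2 b3 a0 x0 a3 x3 : C}
    (h3 : a0 ≠ x0) (h1' : b3 ≠ a3) (h2' : b3 ≠ x3) (h3' : a3 ≠ x3)
    (ha0 : a0 = b1) (hx3 : x3 = b2) :
    ∃ a1 a2 x1 x2, TriangleOK b0 b1 a0 a1 x0 x1 ∧ TriangleOK b1 b2 a1 a2 x1 x2 ∧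
      TriangleOK b2 b3 a2 a3 x2 x3 := by
  obtain ⟨a1, ha1⟩ := hC b0 b1 x0
  obtain ⟨x2, hx2⟩ := hC b2 b3 a3
  by_cases e : x2 = b1
  · obtain ⟨x1, hx1⟩ := hC a1 b1 b2
    obtain ⟨a2, ha2⟩ := hC b1 b2 x1
    refine ⟨a1, a2, x1, x2, ?_, ?_, ?_⟩ <;> simp only [TriangleOK] <;> grind
  · obtain ⟨a2, ha2⟩ := hC x2 b1 b2
    obtain ⟨x1, hx1⟩ := hC a1 b1 a2
    refine ⟨a1, a2, x1, x2, ?_, ?_, ?_⟩ <;> simp only [TriangleOK] <;> grind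

lemma TriangleOK.swap {b b' a a' x x' : C} (H : TriangleOK b b' a a' x x') :
    TriangleOK b b' x x' a a' := by
  simp only [TriangleOK] at *
  grind

lemma exists_two_of_triangle (hC : HasFourColors C) (b : Schedule C) {a0 x0 a3 x3 : C}
    (h1 : b.c0 ≠ a0) (h2 : b.c0 ≠ x0) (h3 : a0 ≠ x0)
    (h1' : b.c3 ≠ a3) (h2' : b.c3 ≠ x3) (h3' : a3 ≠ x3) :
    ∃ a x : Schedule C, a.c0 = a0 ∧ a.c3 = a3 ∧ x.c0 = x0 ∧ x.c3 = x3 ∧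
      Compatible b a ∧ Compatible a x ∧ Compatible x b := by
  obtain ⟨a1, a2, x1, x2, t1, t2, t3⟩ : ∃ a1 a2 x1 x2, TriangleOK b.c0 b.c1 a0 a1 x0 x1 ∧
      TriangleOK b.c1 b.c2 a1 a2 x1 x2 ∧ TriangleOK b.c2 b.c3 a2 a3 x2 x3 := by
    by_cases e1 : x0 = b.c1
    · by_cases e2 : a3 = b.c2
      · obtain ⟨x1, x2, a1, a2, t1, t2, t3⟩ := exists_triangle_of_copies hC h3.symm h2' h1'
          h3'.symm e1 e2
        exact ⟨a1, a2, x1, x2, t1.swap, t2.swap, t3.swap⟩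
      · obtain ⟨x1, x2, a1, a2, t1, t2, t3⟩ := exists_triangle_of_free hC h1 h3.symm h2' h1'
          h3'.symm (b1 := b.c1) (by grind) e2
        exact ⟨a1, a2, x1, x2, t1.swap, t2.swap, t3.swap⟩
    · by_cases e2 : x3 = b.c2
      · by_cases e3 : a0 = b.c1
        · exact exists_triangle_of_copies hC h3 h1' h2' h3' e3 e2
        · obtain ⟨x1, x2, a1, a2, t1, t2, t3⟩ := exists_triangle_of_free hC h1 h3.symm h2' h1'
            h3'.symm e3 (b2 := b.c2) (by grind)
          exact ⟨a1, a2, x1, x2, t1.swap, t2.swap, t3.swap⟩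
      · exact exists_triangle_of_free hC h2 h3 h1' h2' h3' e1 e2
  obtain ⟨i1, j1, p1⟩ := exists_passOK_triangle b.h1 h1 h2 h3 t1.1 t1.2.1 t1.2.2.1
    t1.2.2.2.1 t1.2.2.2.2.1 t1.2.2.2.2.2.1 t1.2.2.2.2.2.2.1 t1.2.2.2.2.2.2.2
  obtain ⟨i2, j2, p2⟩ := exists_passOK_triangle b.h2 t1.1 t1.2.1 t1.2.2.1 t2.1 t2.2.1 t2.2.2.1
    t2.2.2.2.1 t2.2.2.2.2.1 t2.2.2.2.2.2.1 t2.2.2.2.2.2.2.1 t2.2.2.2.2.2.2.2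
  obtain ⟨i3, j3, p3⟩ := exists_passOK_triangle b.h3 t2.1 t2.2.1 t2.2.2.1 t3.1 t3.2.1 t3.2.2.1
    t3.2.2.2.1 t3.2.2.2.2.1 t3.2.2.2.2.2.1 t3.2.2.2.2.2.2.1 t3.2.2.2.2.2.2.2
  exact ⟨⟨a0, a1, a2, a3, i1, i2, i3⟩, ⟨x0, x1, x2, x3, j1, j2, j3⟩, rfl, rfl, rfl, rfl,
    ⟨p1.1, p2.1, p3.1⟩, ⟨p1.2.2, p2.2.2, p3.2.2⟩,
    ⟨p1.2.1.symm, p2.2.1.symm, p3.2.1.symm⟩⟩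

lemma exists_path_between (hC : HasFourColors C) (b : Schedule C) (n : ℕ) :
    ∀ (q : Schedule C) (A B : ℕ → C), q.c0 ≠ A 0 → q.c3 ≠ B 0 → b.c0 ≠ A (n + 2) →
      b.c3 ≠ B (n + 2) → b.c1 ≠ A (n + 2) → (∀ i < n + 2, A i ≠ A (i + 1)) →
      (∀ i < n + 2, B i ≠ B (i + 1)) →
      ∃ M : ℕ → Schedule C, (∀ i < n + 3, (M i).c0 = A i ∧ (M i).c3 = B i) ∧
        (∀ i < n + 2, Compatible (M i) (M (i + 1))) ∧ Compatible q (M 0) ∧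
        Compatible (M (n + 2)) b := by
  induction n with
  | zero =>
    intro q A B h1 h2 h3 h4 h5 hA hB
    obtain ⟨p, a, x, e⟩ := exists_three_between hC q b h1 (hA 0 (by lia)) (hA 1 (by lia)) h3 h2
      (hB 0 (by lia)) (hB 1 (by lia)) h4 h5
    refine ⟨fun i => if i = 0 then p else if i = 1 then a else x, fun i hi => ?_, fun i hi => ?_,
      by simp [e], by simp [e]⟩
    · interval_cases i <;> simp [e]
    · interval_cases i <;> simp [e]
  | succ n ih =>
    intro q A B h1 h2 h3 h4 h5 hA hB
    obtain ⟨y, y0, y3, -, hy⟩ := exists_compatible hC q q.c0 h1 h2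
    obtain ⟨M, m1, m2, m3, m4⟩ := ih y (fun i => A (i + 1)) (fun i => B (i + 1))
      (y0 ▸ hA 0 (by lia)) (y3 ▸ hB 0 (by lia)) h3 h4 h5 (fun i hi => hA _ (by lia))
      (fun i hi => hB _ (by lia))
    refine ⟨fun i => Nat.casesOn i y M, fun i hi => ?_, fun i hi => ?_, hy, m4⟩
    · cases i with
      | zero => exact ⟨y0, y3⟩
      | succ i => exact m1 i (by lia)
    · cases i with
      | zero => exact m3
      | succ i => exact m2 i (by lia)

/-- Schedules for the other vertices of a cycle of length `n + 3` through a vertex with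
schedule `v`. -/
lemma exists_cycle (hC : HasFourColors C) (v : Schedule C) (n : ℕ) (A B : ℕ → C)
    (h1 : v.c0 ≠ A 0) (h2 : v.c3 ≠ B 0) (h3 : v.c0 ≠ A (n + 1)) (h4 : v.c3 ≠ B (n + 1))
    (hA : ∀ i < n + 1, A i ≠ A (i + 1)) (hB : ∀ i < n + 1, B i ≠ B (i + 1)) :
    ∃ M : ℕ → Schedule C, (∀ i < n + 2, (M i).c0 = A i ∧ (M i).c3 = B i) ∧
      (∀ i < n + 1, Compatible (M i) (M (i + 1))) ∧ Compatible v (M 0) ∧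
      Compatible v (M (n + 1)) := by
  match n with
  | 0 =>
    obtain ⟨a, x, e1, e2, e3, e4, e5, e6, e7⟩ := exists_two_of_triangle hC v h1 h3
      (hA 0 (by lia)) h2 h4 (hB 0 (by lia))
    refine ⟨fun i => if i = 0 then a else x, fun i hi => ?_, fun i hi => ?_,
      by simp [e5], by simp [e7.symm]⟩
    · interval_cases i <;> simp [*]
    · interval_cases i
      simp [e6]
  | 1 =>
    obtain ⟨p, a, x, e1, e2, e3, e4, e5, e6, e7, e8, e9, e10⟩ := exists_three_of_cycle hC v h1
      (hA 0 (by lia)) (hA 1 (by lia)) h3 h2 (hB 0 (by lia)) (hB 1 (by lia)) h4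
    refine ⟨fun i => if i = 0 then p else if i = 1 then a else x, fun i hi => ?_, fun i hi => ?_,
      by simp [e7], by simp [e10.symm]⟩
    · interval_cases i <;> simp [*]
    · interval_cases i <;> simp [*]
  | n + 2 =>
    obtain ⟨w, w0, w3, w1, hw⟩ := exists_compatible hC v (A (n + 2)) h3 h4
    obtain ⟨M, m1, m2, m3, m4⟩ := exists_path_between hC w n v A B h1 h2
      (w0 ▸ (hA (n + 2) (by lia)).symm) (w3 ▸ (hB (n + 2) (by lia)).symm) w1
      (fun i hi => hA i (by lia)) (fun i hi => hB i (by lia))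
    refine ⟨fun i => if i < n + 3 then M i else w, fun i hi => ?_, fun i hi => ?_,
      by simpa using m3, by simpa using hw⟩
    · by_cases e : i < n + 3
      · simpa [e] using m1 i e
      · obtain rfl : i = n + 3 := by lia
        simpa using ⟨w0, w3⟩
    · by_cases e : i < n + 2
      · simpa [e, show i < n + 3 by lia] using m2 i e
      · obtain rfl : i = n + 2 := by lia
        simpa using m4

end Schedules

section Passes

variable {V : Type} {G : SimpleGraph V} {ℓ : ℕ}

/-- `α` can be transformed into `β` recoloring every vertex `v` at most `n v` times. -/
def RecolorableWithin (G : SimpleGraph V) (α β : V → Fin ℓ) (n : V → ℕ) : Prop :=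
  ∃ (m : ℕ) (c : Fin (m + 1) → V → Fin ℓ), IsTransformSeq G c α β ∧ ∀ v, RecolorCount c v ≤ n v

lemma RecolorableWithin.refl {α : V → Fin ℓ} (hα : IsProperColoring G α) (n : V → ℕ) :
    RecolorableWithin G α α n :=
  ⟨0, fun _ => α, ⟨rfl, rfl, fun _ => hα, fun i => i.elim0⟩, fun v => by simp [RecolorCount]⟩

lemma RecolorableWithin.cons {α α' β : V → Fin ℓ} {n n' : V → ℕ} {v : V}
    (hα : IsProperColoring G α) (hv : α v ≠ α' v) (heq : ∀ u, u ≠ v → α u = α' u)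
    (hn : n v + 1 ≤ n' v) (hle : ∀ u, n u ≤ n' u) (H : RecolorableWithin G α' β n) :
    RecolorableWithin G α β n' := by
  obtain ⟨m, c, ⟨h0, hl, hp, hs⟩, hc⟩ := H
  refine ⟨m + 1, Fin.cons α c, ⟨rfl, ?_, ?_, ?_⟩, ?_⟩
  · rw [← Fin.succ_last, Fin.cons_succ, hl]
  · intro i
    refine Fin.cases ?_ (fun j => ?_) i
    · simpa using hα
    · simpa using hp j
  · intro i
    refine Fin.cases ?_ (fun j => ?_) i
    · refine ⟨v, ?_, fun u hu => ?_⟩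
      · simpa [h0] using hv
      · by_contra h
        exact hu (by simpa [h0] using heq u h)
    · rw [← Fin.succ_castSucc]
      simpa only [Fin.cons_succ] using hs j
  · intro u
    have key : RecolorCount (Fin.cons α c : Fin (m + 1 + 1) → V → Fin ℓ) u =
        (if α u ≠ α' u then 1 else 0) + RecolorCount c u := by
      simp only [RecolorCount, Finset.card_filter]
      rw [Fin.sum_univ_succ, ← h0]
      rfl
    rw [key]
    by_cases huv : u = v
    · subst huv
      rw [if_pos hv]
      have := hc u
      omega
    · rw [if_neg (not_not.2 (heq u huv)), zero_add]
      exact (hc u).trans (hle u)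

lemma RecolorableWithin.of_pass [Finite V] {α β γ : V → Fin ℓ} (h : V → ℤ) {n : V → ℕ}
    (hα : IsProperColoring G α) (hβ : IsProperColoring G β)
    (hpass : ∀ u w, G.Adj u w → β u = α w → h w < h u)
    (H : RecolorableWithin G β γ n) : RecolorableWithin G α γ (fun v => n v + 1) := by
  classical
  have := Fintype.ofFinite V
  suffices ∀ (k : ℕ) (α : V → Fin ℓ), (Finset.univ.filter fun v => α v ≠ β v).card = k →
      IsProperColoring G α → (∀ u w, G.Adj u w → β u = α w → h w < h u) →
      RecolorableWithin G α γ (fun v => n v + if α v = β v then 0 else 1) by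
    obtain ⟨m, c, hc, hle⟩ := this _ α rfl hα hpass
    exact ⟨m, c, hc, fun v => (hle v).trans (by dsimp only; split_ifs <;> omega)⟩
  intro k
  induction k with
  | zero =>
    intro α hk _ _
    have : α = β := by
      funext v
      by_contra hv
      simpa [hv] using Finset.ext_iff.1 (Finset.card_eq_zero.1 hk) v
    subst this
    simpa using H
  | succ k ih =>
    intro α hk hα hpass
    have hne : (Finset.univ.filter fun v => α v ≠ β v).Nonempty := by
      rw [← Finset.card_pos]; omega
    obtain ⟨v, hv, hmin⟩ := Finset.exists_min_image _ h hne
    have hv' : α v ≠ β v := by simpa using hv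
    have hfree : ∀ w, G.Adj v w → β v ≠ α w := by
      intro w hw e
      have hlt := hpass v w hw e
      have hwd : α w ≠ β w := fun e' => hβ hw (e.trans e')
      exact absurd (hmin w (by simpa using hwd)) (by omega)
    have hup : ∀ u, u ≠ v → Function.update α v (β v) u = α u :=
      fun u hu => Function.update_of_ne hu _ _
    have hself : Function.update α v (β v) v = β v := Function.update_self _ _ _
    have hcard : (Finset.univ.filter fun u => Function.update α v (β v) u ≠ β u) =
        (Finset.univ.filter fun u => α u ≠ β u).erase v := by
      ext u
      by_cases hu : u = v
      · subst hu; simp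
      · simp [hu]
    have hrec := ih (Function.update α v (β v)) (by rw [hcard, Finset.card_erase_of_mem hv]; omega)
      (by
        intro a b hab
        by_cases ha : a = v
        · subst ha
          rw [hself, hup b hab.ne']
          exact hfree b hab
        · rw [hup a ha]
          by_cases hb : b = v
          · subst hb
            rw [hself]
            exact (hfree a hab.symm).symm
          · rw [hup b hb]
            exact hα hab)
      (by
        intro a b hab e
        by_cases hb : b = v
        · subst hb
          rw [hself] at e
          exact absurd e (hβ hab)
        · rw [hup b hb] at e
          exact hpass a b hab e)
    refine RecolorableWithin.cons (v := v) hα (by rwa [hself]) (fun u hu => (hup u hu).symm) ?_ ?_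
      hrec
    · simp [hv']
    · intro u
      by_cases hu : u = v
      · subst hu; simp
      · simp [hu]

end Passes

section Ears

variable {V : Type} {G : SimpleGraph V}

/-- In a graph whose edges lie on at most one cycle, no path joins two vertices of a cycle
from the outside. -/
lemma EdgeOnAtMostOneCycle.no_ear (hG : EdgeOnAtMostOneCycle G) {s t t' a b : V} {C : G.Walk s s}
    (hC : C.IsCycle) (ht : t ∈ C.support) (ht' : t' ∈ C.support) (hne : t ≠ t')
    (hta : G.Adj t a) (hbt : G.Adj b t') (w : G.Walk a b) (hw : ∀ x ∈ w.support, x ∉ C.support) :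
    False := by
  classical
  have hsup : ∀ x, x ∈ (C.rotate t ht).support ↔ x ∈ C.support := fun x =>
    Walk.mem_support_rotate_iff ..
  have hedge : ∀ e, e ∈ (C.rotate t ht).edges ↔ e ∈ C.edges := fun e =>
    (Walk.rotate_edges C t ht).mem_iff
  have hc : (C.rotate t ht).IsCycle := hC.rotate ht
  have ht'' : t' ∈ (C.rotate t ht).support := (hsup t').2 ht'
  set D := ((C.rotate t ht).takeUntil t' ht'').reverse with hD
  have hDpath : D.IsPath := (hc.isPath_takeUntil ht'').reverse
  have hDsup : ∀ x ∈ D.support, x ∈ C.support := fun x hx => (hsup x).1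
    (Walk.support_takeUntil_subset_support _ ht'' (by simpa [hD] using hx))
  have hDedge : ∀ e ∈ D.edges, e ∈ C.edges := fun e he => (hedge e).1
    (Walk.edges_takeUntil_subset_edges _ ht'' (by simpa [hD] using he))
  have hQ : ∀ x ∈ w.bypass.support, x ∉ C.support := fun x hx =>
    hw x (Walk.support_bypass_subset_support _ hx)
  have haC : a ∉ C.support := hw a w.start_mem_support
  have hbC : b ∉ C.support := hw b w.end_mem_support
  have hpath : (w.bypass.append (Walk.cons hbt D)).IsPath := by
    rw [Walk.isPath_def, Walk.support_append, Walk.support_cons, List.tail_cons]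
    exact (w.bypass_isPath.support_nodup).append hDpath.support_nodup
      fun x hx hx' => hQ x hx (hDsup x hx')
  have hcyc : (Walk.cons hta (w.bypass.append (Walk.cons hbt D))).IsCycle := by
    refine (Walk.cons_isCycle_iff _ _).2 ⟨hpath, fun he => ?_⟩
    rw [Walk.edges_append, Walk.edges_cons, List.mem_append, List.mem_cons] at he
    rcases he with he | he | he
    · exact hQ t (Walk.fst_mem_support_of_mem_edges _ he) ht
    · rcases Sym2.eq_iff.1 he with ⟨h1, -⟩ | ⟨h1, -⟩
      · exact hbC (h1 ▸ ht)
      · exact hne h1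
    · exact haC (hDsup a (Walk.snd_mem_support_of_mem_edges _ he))
  obtain ⟨e, he⟩ : ∃ e, e ∈ D.edges := by
    refine List.exists_mem_of_ne_nil _ fun h => hne ?_
    have : D.length = 0 := by rw [← Walk.length_edges, h]; rfl
    exact (Walk.eq_of_length_eq_zero this).symm
  have := (hG _ _ _ _ hcyc hC e (by simp [he]) (hDedge e he) s(t, a)).1 (by simp)
  exact haC (Walk.snd_mem_support_of_mem_edges _ this)

/-- Every connected piece of the complement of `S` is attached to at most one vertex of `S`. -/
def Gated (G : SimpleGraph V) (S : Set V) : Prop :=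
  ∀ ⦃a b⦄ (w : G.Walk a b), (∀ x ∈ w.support, x ∉ S) →
    ∀ ⦃s s'⦄, s ∈ S → s' ∈ S → G.Adj s a → G.Adj b s' → s = s'

lemma Gated.eq_of_adj {S : Set V} (hS : Gated G S) {u s s' : V} (hu : u ∉ S) (hs : s ∈ S)
    (hs' : s' ∈ S) (h : G.Adj s u) (h' : G.Adj s' u) : s = s' :=
  hS (Walk.nil : G.Walk u u) (by simpa using hu) hs hs' h h'.symm

lemma Gated.insert {S : Set V} (hS : Gated G S) {s u : V} (hs : s ∈ S) (hu : u ∉ S)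
    (hsu : G.Adj s u)
    (h : ∀ u' (w : G.Walk u u'), (∀ x ∈ w.support, x ∉ S) → G.Adj s u' → u' = u) :
    Gated G (insert u S) := by
  have key : ∀ ⦃a b⦄ (w : G.Walk a b), (∀ x ∈ w.support, x ∉ Insert.insert u S) →
      ∀ ⦃t⦄, t ∈ S → G.Adj u a → G.Adj b t → False := by
    intro a b w hw t ht hua hbt
    have hw' : ∀ x ∈ (Walk.cons hua w).support, x ∉ S := by
      intro x hx
      rw [Walk.support_cons, List.mem_cons] at hx
      rcases hx with rfl | hx
      · exact hu
      · exact fun hxS => hw x hx (Or.inr hxS)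
    obtain rfl := hS _ hw' hs ht hsu hbt
    exact hw b w.end_mem_support (Or.inl (h b _ hw' hbt.symm))
  rintro a b w hw t t' (rfl | ht) (rfl | ht') hta hbt
  · rfl
  · exact (key w hw ht' hta hbt).elim
  · exact (key w.reverse (by simpa using hw) ht hbt.symm hta.symm).elim
  · exact hS w (fun x hx hxS => hw x hx (Or.inr hxS)) ht ht' hta hbt

lemma Gated.union_support {S : Set V} (hG : EdgeOnAtMostOneCycle G) (hS : Gated G S)
    {s u₁ u₂ : V} (hs : s ∈ S) (h₁ : G.Adj s u₁) (h₂ : G.Adj s u₂) (hne : u₁ ≠ u₂)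
    (P : G.Walk u₁ u₂) (hP : P.IsPath) (hPS : ∀ x ∈ P.support, x ∉ S) :
    Gated G (S ∪ {x | x ∈ P.support}) := by
  classical
  have hcyc : (Walk.cons h₁ (P.concat h₂.symm)).IsCycle := by
    refine (Walk.cons_isCycle_iff _ _).2
      ⟨(Walk.concat_isPath_iff _).2 ⟨hP, fun h => hPS s h hs⟩, fun he => ?_⟩
    rw [Walk.edges_concat, List.concat_eq_append, List.mem_append, List.mem_singleton] at he
    rcases he with he | he
    · exact hPS s (Walk.fst_mem_support_of_mem_edges _ he) hs
    · rcases Sym2.eq_iff.1 he with ⟨h, -⟩ | ⟨-, h⟩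
      · exact h₂.ne h
      · exact hne h
  have hmem : ∀ x, x ∈ (Walk.cons h₁ (P.concat h₂.symm)).support ↔ x = s ∨ x ∈ P.support := by
    intro x
    simp only [Walk.support_cons, Walk.support_concat, List.mem_cons, List.mem_append,
      List.not_mem_nil, or_false]
    tauto
  have key : ∀ ⦃a b⦄ (w : G.Walk a b), (∀ x ∈ w.support, x ∉ S ∪ {x | x ∈ P.support}) →
      ∀ ⦃t t'⦄, t ∈ S → t' ∈ P.support → G.Adj t a → G.Adj b t' → t = s := by
    intro a b w hw t t' ht ht' hta hbt
    refine hS (w.append (Walk.cons hbt (P.takeUntil t' ht').reverse)) ?_ ht hs hta h₁.symm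
    intro x hx
    rw [Walk.mem_support_append_iff, Walk.support_cons, List.mem_cons, Walk.support_reverse,
      List.mem_reverse] at hx
    rcases hx with hx | rfl | hx
    · exact fun hxS => hw x hx (Or.inl hxS)
    · exact fun hxS => hw x w.end_mem_support (Or.inl hxS)
    · exact hPS x (Walk.support_takeUntil_subset_support _ _ hx)
  intro a b w hw t t' ht ht' hta hbt
  by_contra htt
  have hoff : ∀ x ∈ w.support, x ∉ (Walk.cons h₁ (P.concat h₂.symm)).support := by
    intro x hx hxC
    rcases (hmem x).1 hxC with rfl | h
    · exact hw x hx (Or.inl hs)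
    · exact hw x hx (Or.inr h)
  rcases ht with ht | ht <;> rcases ht' with ht' | ht'
  · exact htt (hS w (fun x hx hxS => hw x hx (Or.inl hxS)) ht ht' hta hbt)
  · exact hG.no_ear hcyc ((hmem t).2 (Or.inl (key w hw ht ht' hta hbt)))
      ((hmem t').2 (Or.inr ht')) htt hta hbt w hoff
  · exact hG.no_ear hcyc ((hmem t).2 (Or.inr ht)) ((hmem t').2
      (Or.inl (key w.reverse (by simpa using hw) ht' ht hbt.symm hta.symm))) htt hta hbt w hoff
  · exact hG.no_ear hcyc ((hmem t).2 (Or.inr ht)) ((hmem t').2 (Or.inr ht')) htt hta hbt w hoff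

/-- If two neighbours of `s` outside of `S` are joined outside of `S`, then a shortest such
connection is an induced path meeting the neighbourhood of `S` in its end points only. -/
lemma Gated.exists_ear {S : Set V} (hG : EdgeOnAtMostOneCycle G) (hS : Gated G S)
    {s u u' : V} (hs : s ∈ S) (hu : G.Adj s u) (hu' : G.Adj s u') (hne : u ≠ u')
    (w : G.Walk u u') (hw : ∀ x ∈ w.support, x ∉ S) :
    ∃ (n : ℕ) (p : ℕ → V), G.Adj s (p 0) ∧ G.Adj s (p (n + 1)) ∧
      (∀ i < n + 2, ∀ j < n + 2, p i = p j → i = j) ∧ (∀ i < n + 2, p i ∉ S) ∧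
      (∀ i < n + 1, G.Adj (p i) (p (i + 1))) ∧
      (∀ i j, i < j → j < n + 2 → G.Adj (p i) (p j) → j = i + 1) ∧
      (∀ i < n + 2, ∀ t ∈ S, G.Adj t (p i) → t = s ∧ (i = 0 ∨ i = n + 1)) ∧
      Gated G (S ∪ {x | ∃ i < n + 2, p i = x}) := by
  classical
  have hex : ∃ (k : ℕ) (v v' : V) (P : G.Walk v v'), P.length = k ∧ v ≠ v' ∧ G.Adj s v ∧
      G.Adj s v' ∧ ∀ x ∈ P.support, x ∉ S := ⟨_, u, u', w, rfl, hne, hu, hu', hw⟩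
  obtain ⟨v, v', P₀, hlen, hvv, hv, hv', hP₀⟩ := Nat.find_spec hex
  have hmin₀ : ∀ v v' (Q : G.Walk v v'), v ≠ v' → G.Adj s v → G.Adj s v' →
      (∀ x ∈ Q.support, x ∉ S) → P₀.length ≤ Q.length := fun v v' Q h1 h2 h3 h4 =>
    hlen.trans_le (Nat.find_min' hex ⟨v, v', Q, rfl, h1, h2, h3, h4⟩)
  obtain ⟨P, hP, hPS, hmin⟩ : ∃ P : G.Walk v v', P.IsPath ∧ (∀ x ∈ P.support, x ∉ S) ∧
      ∀ v v' (Q : G.Walk v v'), v ≠ v' → G.Adj s v → G.Adj s v' →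
        (∀ x ∈ Q.support, x ∉ S) → P.length ≤ Q.length :=
    ⟨P₀.bypass, P₀.bypass_isPath, fun x hx => hP₀ x (Walk.support_bypass_subset_support _ hx),
      fun _ _ Q h1 h2 h3 h4 => (Walk.length_bypass_le_length _).trans (hmin₀ _ _ Q h1 h2 h3 h4)⟩
  obtain ⟨n, hn⟩ : ∃ n, P.length = n + 1 := by
    refine Nat.exists_eq_succ_of_ne_zero fun h => hvv (Walk.eq_of_length_eq_zero h)
  have hlast : P.getVert (n + 1) = v' := by rw [← hn, Walk.getVert_length]
  have htake : ∀ i, ∀ x ∈ (P.take i).support, x ∉ S := fun i x hx =>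
    hPS x (by rw [Walk.support_take] at hx; exact List.mem_of_mem_take hx)
  have hdrop : ∀ i, ∀ x ∈ (P.drop i).support, x ∉ S := fun i x hx =>
    hPS x (by
      obtain ⟨k, rfl, -⟩ := Walk.mem_support_iff_exists_getVert.1 hx
      rw [Walk.drop_getVert]
      exact P.getVert_mem_support _)
  refine ⟨n, P.getVert, by simpa using hv, by rwa [hlast], ?_, fun i _ =>
    hPS _ (P.getVert_mem_support i), fun i hi => P.adj_getVert_succ (by omega), ?_, ?_, ?_⟩
  · intro i hi j hj h
    exact hP.getVert_injOn (by simp; omega) (by simp; omega) h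
  · intro i j hij hj hadj
    have hle := hmin v v' ((P.take i).append (Walk.cons hadj (P.drop j))) hvv hv hv' (by
      intro x hx
      rw [Walk.mem_support_append_iff, Walk.support_cons, List.mem_cons] at hx
      rcases hx with hx | rfl | hx
      · exact htake i x hx
      · exact hPS _ (P.getVert_mem_support i)
      · exact hdrop j x hx)
    rw [Walk.length_append, Walk.length_cons, Walk.take_length, Walk.drop_length] at hle
    omega
  · intro i hi t ht hti
    obtain rfl : t = s := by
      refine hS (P.take i).reverse ?_ ht hs hti hv.symm
      simpa using htake i
    refine ⟨rfl, ?_⟩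
    by_contra! hi'
    have hle := hmin v (P.getVert i) (P.take i) (fun h => hi'.1 ?_) hv hti (htake i)
    · rw [Walk.take_length] at hle
      omega
    · exact hP.getVert_injOn (by simp; omega) (by simp) (by rw [← h, Walk.getVert_zero])
  · convert Gated.union_support hG hS hs hv hv' hvv P hP hPS using 3
    ext x
    rw [Walk.mem_support_iff_exists_getVert]
    exact ⟨fun ⟨i, h1, h2⟩ => ⟨i, h2, by omega⟩, fun ⟨i, h1, h2⟩ => ⟨i, by omega, h1⟩⟩

end Ears

section Growth

variable {V C : Type} {G : SimpleGraph V} {α β : V → C} {S : Set V}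

/-- The vertices of `S` have pairwise compatible schedules leading from `α` to `β`. -/
def SchedulableOn (G : SimpleGraph V) (α β : V → C) (S : Set V) : Prop :=
  ∃ F : V → Schedule C, (∀ v ∈ S, (F v).c0 = α v ∧ (F v).c3 = β v) ∧
    ∀ u ∈ S, ∀ v ∈ S, G.Adj u v → Compatible (F u) (F v)

lemma SchedulableOn.union {T : Set V} (hd : ∀ x ∈ T, x ∉ S) {F M : V → Schedule C}
    (hF : (∀ v ∈ S, (F v).c0 = α v ∧ (F v).c3 = β v) ∧
      ∀ u ∈ S, ∀ v ∈ S, G.Adj u v → Compatible (F u) (F v))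
    (hM : (∀ v ∈ T, (M v).c0 = α v ∧ (M v).c3 = β v) ∧
      ∀ u ∈ T, ∀ v ∈ T, G.Adj u v → Compatible (M u) (M v))
    (hFM : ∀ u ∈ S, ∀ v ∈ T, G.Adj u v → Compatible (F u) (M v)) :
    SchedulableOn G α β (S ∪ T) := by
  classical
  have hS : ∀ x ∈ S, (if x ∈ T then M x else F x) = F x := fun x hx =>
    if_neg fun hxT => hd x hxT hx
  have hT : ∀ x ∈ T, (if x ∈ T then M x else F x) = M x := fun x hx => if_pos hx
  refine ⟨fun x => if x ∈ T then M x else F x, ?_, ?_⟩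
  · rintro v (hv | hv)
    · simpa only [hS v hv] using hF.1 v hv
    · simpa only [hT v hv] using hM.1 v hv
  · rintro u (hu | hu) v (hv | hv) huv
    · simpa only [hS v hv, hS u hu] using hF.2 u hu v hv huv
    · simpa only [hT v hv, hS u hu] using hFM u hu v hv huv
    · simpa only [hS v hv, hT u hu] using (hFM v hv u hu huv.symm).symm
    · simpa only [hT v hv, hT u hu] using hM.2 u hu v hv huv

lemma SchedulableOn.insert (hC : HasFourColors C) (hα : ∀ u v, G.Adj u v → α u ≠ α v)
    (hβ : ∀ u v, G.Adj u v → β u ≠ β v) (H : SchedulableOn G α β S) {s u : V} (hs : s ∈ S)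
    (hu : u ∉ S) (hsu : G.Adj s u) (hnbr : ∀ t ∈ S, G.Adj t u → t = s) :
    SchedulableOn G α β (insert u S) := by
  obtain ⟨F, hF, hFF⟩ := H
  obtain ⟨x, hx0, hx3, -, hx⟩ := exists_compatible hC (F s) (x0 := α u) (x3 := β u) (α u)
    (by rw [(hF s hs).1]; exact hα s u hsu) (by rw [(hF s hs).2]; exact hβ s u hsu)
  rw [Set.insert_eq, Set.union_comm]
  refine SchedulableOn.union (M := fun _ => x) (by simpa using hu) ⟨hF, hFF⟩ ⟨?_, ?_⟩ ?_
  · rintro v rfl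
    exact ⟨hx0, hx3⟩
  · rintro v rfl v' rfl h
    exact (h.ne rfl).elim
  · rintro t ht v rfl h
    rwa [hnbr t ht h]

lemma SchedulableOn.union_ear (hC : HasFourColors C) (hα : ∀ u v, G.Adj u v → α u ≠ α v)
    (hβ : ∀ u v, G.Adj u v → β u ≠ β v) (H : SchedulableOn G α β S) {s : V} (hs : s ∈ S) {n : ℕ}
    {p : ℕ → V} (h0 : G.Adj s (p 0)) (hn : G.Adj s (p (n + 1)))
    (hinj : ∀ i < n + 2, ∀ j < n + 2, p i = p j → i = j) (hpS : ∀ i < n + 2, p i ∉ S)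
    (hadj : ∀ i < n + 1, G.Adj (p i) (p (i + 1)))
    (hchord : ∀ i j, i < j → j < n + 2 → G.Adj (p i) (p j) → j = i + 1)
    (hnbr : ∀ i < n + 2, ∀ t ∈ S, G.Adj t (p i) → t = s ∧ (i = 0 ∨ i = n + 1)) :
    SchedulableOn G α β (S ∪ {x | ∃ i < n + 2, p i = x}) := by
  classical
  obtain ⟨F, hF, hFF⟩ := H
  have hs0 := (hF s hs).1
  have hs3 := (hF s hs).2
  obtain ⟨M, hM, hMM, hM0, hMn⟩ := exists_cycle hC (F s) n (α ∘ p) (β ∘ p)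
    (by rw [hs0]; exact hα _ _ h0) (by rw [hs3]; exact hβ _ _ h0)
    (by rw [hs0]; exact hα _ _ hn) (by rw [hs3]; exact hβ _ _ hn)
    (fun i hi => hα _ _ (hadj i hi)) (fun i hi => hβ _ _ (hadj i hi))
  obtain ⟨N, hN⟩ : ∃ N : V → Schedule C, ∀ i < n + 2, N (p i) = M i := by
    refine ⟨fun x => if h : ∃ i < n + 2, p i = x then M h.choose else F x, fun i hi => ?_⟩
    have h : ∃ j < n + 2, p j = p i := ⟨i, hi, rfl⟩
    dsimp only
    rw [dif_pos h, hinj _ h.choose_spec.1 _ hi h.choose_spec.2]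
  refine SchedulableOn.union (M := N) ?_ ⟨hF, hFF⟩ ⟨?_, ?_⟩ ?_
  · rintro _ ⟨i, hi, rfl⟩
    exact hpS i hi
  · rintro _ ⟨i, hi, rfl⟩
    rw [hN i hi]
    exact hM i hi
  · rintro _ ⟨i, hi, rfl⟩ _ ⟨j, hj, rfl⟩ h
    rw [hN i hi, hN j hj]
    rcases lt_trichotomy i j with hij | rfl | hij
    · obtain rfl := hchord i j hij hj h
      exact hMM i (by omega)
    · exact (h.ne rfl).elim
    · obtain rfl := hchord j i hij hi h.symm
      exact (hMM j (by omega)).symm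
  · rintro t ht _ ⟨i, hi, rfl⟩ h
    rw [hN i hi]
    obtain ⟨rfl, rfl | rfl⟩ := hnbr i hi t ht h
    · exact hM0
    · exact hMn

lemma IsCactus.schedulableOn_univ [Finite V] (hG : IsCactus G) (hC : HasFourColors C)
    (hα : ∀ u v, G.Adj u v → α u ≠ α v) (hβ : ∀ u v, G.Adj u v → β u ≠ β v) :
    SchedulableOn G α β Set.univ := by
  obtain ⟨r⟩ := hG.1.nonempty
  have hr : ({r} : Set V).Nonempty ∧ Gated G {r} ∧ SchedulableOn G α β {r} := by
    refine ⟨Set.singleton_nonempty r, ?_, fun _ => ⟨α r, α r, α r, β r, 0, 0, 0⟩, ?_, ?_⟩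
    · rintro a b w - s s' rfl rfl - -
      rfl
    · rintro v rfl
      exact ⟨rfl, rfl⟩
    · rintro u rfl v rfl h
      exact (h.ne rfl).elim
  obtain ⟨S, ⟨hne, hgate, hsch⟩, hmax⟩ := Set.Finite.exists_maximal
    (s := {S : Set V | S.Nonempty ∧ Gated G S ∧ SchedulableOn G α β S}) (Set.toFinite _) ⟨_, hr⟩
  suffices S = Set.univ from this ▸ hsch
  by_contra hS
  obtain ⟨y, hy⟩ := (Set.ne_univ_iff_exists_notMem S).1 hS
  obtain ⟨x, hx⟩ := hne
  obtain ⟨w⟩ := hG.1.preconnected x y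
  obtain ⟨⟨⟨s, u⟩, hsu⟩, -, hs, hu⟩ := w.exists_boundary_dart S hx hy
  by_cases h : ∀ u' (w : G.Walk u u'), (∀ x ∈ w.support, x ∉ S) → G.Adj s u' → u' = u
  · exact hu (hmax ⟨⟨x, Or.inr hx⟩, hgate.insert hs hu hsu h, hsch.insert hC hα hβ hs hu hsu
      fun t ht htu => hgate.eq_of_adj hu ht hs htu hsu⟩ (Set.subset_insert u S) (Or.inl rfl))
  · push Not at h
    obtain ⟨u', w, hw, hsu', hne⟩ := h
    obtain ⟨n, p, h0, hn, hinj, hpS, hadj, hchord, hnbr, hgate'⟩ :=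
      hgate.exists_ear hG.2 hs hsu hsu' hne.symm w hw
    exact hpS 0 (by omega) (hmax ⟨⟨x, Or.inl hx⟩, hgate', hsch.union_ear hC hα hβ hs h0 hn hinj
      hpS hadj hchord hnbr⟩ Set.subset_union_left (Or.inr ⟨0, by omega, rfl⟩))

end Growth

lemma hasFourColors_fin {ℓ : ℕ} (hℓ : 4 ≤ ℓ) : HasFourColors (Fin ℓ) := by
  intro a b c
  obtain ⟨d, hd⟩ : ∃ d, d ∉ ({a, b, c} : Finset (Fin ℓ)) := by
    by_contra! h
    have := Finset.card_le_card (fun x _ => h x : Finset.univ ⊆ ({a, b, c} : Finset (Fin ℓ)))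
    rw [Finset.card_univ, Fintype.card_fin] at this
    have := Finset.card_le_three (a := a) (b := b) (c := c)
    omega
  exact ⟨d, by simpa using hd⟩

theorem cactus_recolor {V : Type} [Fintype V] (G : SimpleGraph V) (hG : IsCactus G)
    (ℓ : ℕ) (hℓ : 4 ≤ ℓ) (α β : V → Fin ℓ)
    (hα : IsProperColoring G α) (hβ : IsProperColoring G β) :
    ∃ (m : ℕ) (c : Fin (m + 1) → V → Fin ℓ),
      IsTransformSeq G c α β ∧ ∀ v : V, RecolorCount c v ≤ 3 := by
  obtain ⟨F, hF, hFF⟩ := hG.schedulableOn_univ (hasFourColors_fin hℓ)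
    (fun _ _ h => hα h) (fun _ _ h => hβ h)
  have hF0 : (fun v => (F v).c0) = α := funext fun v => (hF v trivial).1
  have hF3 : (fun v => (F v).c3) = β := funext fun v => (hF v trivial).2
  have hc : ∀ u v, G.Adj u v → Compatible (F u) (F v) := fun u v => hFF u trivial v trivial
  have h1 : IsProperColoring G fun v => (F v).c1 := fun u v h => (hc u v h).1.2.1
  have h2 : IsProperColoring G fun v => (F v).c2 := fun u v h => (hc u v h).2.1.2.1
  rw [← hF0] at hα ⊢
  rw [← hF3] at hβ ⊢
  exact RecolorableWithin.of_pass (fun v => (F v).h1) hα h1 (fun u w h => (hc u w h).1.2.2.1) <|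
    .of_pass (fun v => (F v).h2) h1 h2 (fun u w h => (hc u w h).2.1.2.2.1) <|
    .of_pass (fun v => (F v).h3) h2 hβ (fun u w h => (hc u w h).2.2.2.2.1) <|
    .refl hβ (fun _ => 0)
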